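/- Let G : (0,∞) → ℝ be a smooth function of one variable r such that G(|z₁|² + ⋯ + |zₙ|²) = Φ(z) + conj(Φ(z)) for a holomorphic function Φ on an open subset of ℂⁿ, with n ≥ 2. Then G is constant. -/

import Mathlib

open scoped BigOperators
open Filter Topology

/-- A holomorphic function whose real part is constant on a circle has the same real part at the
center. -/
theorem re_center_eq_of_re_eq_on_sphere {f : ℂ → ℂ} {c : ℂ} {R a : ℝ}
    (hf : AnalyticOnNhd ℂ f (Metric.closedBall c |R|))
    (ha : ∀ s ∈ Metric.sphere c |R|, (f s).re = a) : (f c).re = a := by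
  have hharm : InnerProductSpace.HarmonicOnNhd (fun s ↦ (f s).re) (Metric.closedBall c |R|) :=
    fun s hs ↦ (hf s hs).harmonicAt_re
  rw [← hharm.circleAverage_eq, Real.circleAverage_const_on_circle ha]

/-- The polarization identity for the squared Hermitian norm on `ℂ ^ ι`. -/
theorem sum_norm_sq_add {ι : Type*} [Fintype ι] (z w : ι → ℂ) :
    ∑ j, ‖(z + w) j‖ ^ 2 =
      ∑ j, ‖z j‖ ^ 2 + ∑ j, ‖w j‖ ^ 2 + 2 * (star z ⬝ᵥ w).re := by
  simp only [dotProduct, Complex.re_sum, Finset.mul_sum, ← Finset.sum_add_distrib]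
  refine Finset.sum_congr rfl fun j _ ↦ ?_
  simp [Complex.sq_norm, Complex.normSq_apply]
  ring

theorem sum_norm_sq_smul {ι : Type*} [Fintype ι] (s : ℂ) (w : ι → ℂ) :
    ∑ j, ‖(s • w) j‖ ^ 2 = ‖s‖ ^ 2 * ∑ j, ‖w j‖ ^ 2 := by
  simp [mul_pow, Finset.mul_sum]

theorem exists_ne_zero_star_dotProduct_eq_zero {ι : Type*} [Fintype ι]
    (hι : 1 < Fintype.card ι) (z : ι → ℂ) : ∃ w : ι → ℂ, w ≠ 0 ∧ star z ⬝ᵥ w = 0 := by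
  have hker : LinearMap.ker (dotProductBilin ℂ ℂ (star z)) ≠ ⊥ :=
    LinearMap.ker_ne_bot_of_finrank_lt (by simpa using hι)
  obtain ⟨w, hw, hw0⟩ := Submodule.exists_mem_ne_zero_of_ne_bot hker
  exact ⟨w, hw0, hw⟩

/-- If the real part of a holomorphic function on an open subset of `ℂ ^ ι` is a radial function,
then the radial profile is constant immediately to the right of every radius that is attained. -/
theorem eventually_radial_profile_eq {ι : Type*} [Fintype ι] (hι : 1 < Fintype.card ι)
    {g : ℝ → ℝ} {Φ : (ι → ℂ) → ℂ} {U : Set (ι → ℂ)} (hU : IsOpen U)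
    (hΦ : DifferentiableOn ℂ Φ U) (hg : ∀ z ∈ U, (Φ z).re = g (∑ j, ‖z j‖ ^ 2))
    {z : ι → ℂ} (hz : z ∈ U) :
    ∀ᶠ r in 𝓝[≥] (∑ j, ‖z j‖ ^ 2), g r = g (∑ j, ‖z j‖ ^ 2) := by
  obtain ⟨w, hw0, hzw⟩ := exists_ne_zero_star_dotProduct_eq_zero hι z
  set N := ∑ j, ‖z j‖ ^ 2 with hN
  have hwpos : 0 < ∑ j, ‖w j‖ ^ 2 := by
    obtain ⟨j, hj⟩ := Function.ne_iff.1 hw0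
    exact Finset.sum_pos' (fun _ _ ↦ by positivity)
      ⟨j, Finset.mem_univ j, pow_pos (norm_pos_iff.2 hj) 2⟩
  have hline : Differentiable ℂ fun s : ℂ ↦ z + s • w := by fun_prop
  have hV : IsOpen ((fun s : ℂ ↦ z + s • w) ⁻¹' U) := hU.preimage hline.continuous
  obtain ⟨δ, hδ, hball⟩ := Metric.isOpen_iff.1 hV 0 (by simpa using hz)
  have hrad : ∀ s ∈ Metric.ball (0 : ℂ) δ,
      (Φ (z + s • w)).re = g (N + ‖s‖ ^ 2 * ∑ j, ‖w j‖ ^ 2) := fun s hs ↦ by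
    rw [hg _ (hball hs), sum_norm_sq_add, sum_norm_sq_smul, dotProduct_smul, hzw]
    simp [hN]
  have hanalytic : AnalyticOnNhd ℂ (fun s : ℂ ↦ Φ (z + s • w)) (Metric.ball 0 δ) :=
    (hΦ.comp hline.differentiableOn hball).analyticOnNhd Metric.isOpen_ball
  have hradius : Tendsto (fun r ↦ √((r - N) / ∑ j, ‖w j‖ ^ 2)) (𝓝[≥] N) (𝓝 0) := by
    have hcont : Continuous fun r ↦ √((r - N) / ∑ j, ‖w j‖ ^ 2) := by fun_prop
    simpa using (hcont.tendsto N).mono_left nhdsWithin_le_nhds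
  filter_upwards [hradius.eventually_lt_const hδ, self_mem_nhdsWithin] with r hr hNr
  have hsq := Real.sq_sqrt (div_nonneg (sub_nonneg.2 hNr) hwpos.le)
  set R := √((r - N) / ∑ j, ‖w j‖ ^ 2) with hR
  have hRabs : |R| < δ := by rwa [abs_of_nonneg (Real.sqrt_nonneg _)]
  have hcenter := re_center_eq_of_re_eq_on_sphere (a := g r)
    (hanalytic.mono (Metric.closedBall_subset_ball hRabs)) fun s hs ↦ by
      rw [hrad s (Metric.sphere_subset_closedBall.trans (Metric.closedBall_subset_ball hRabs) hs),
        mem_sphere_zero_iff_norm.1 hs, sq_abs, hsq, div_mul_cancel₀ _ hwpos.ne', add_sub_cancel]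
  rw [← hcenter, zero_smul, add_zero, hg z hz]

/-- If the real part of a holomorphic function on an open subset of `ℂ ^ ι` is a radial function,
then the function has vanishing derivative. -/
theorem fderiv_eq_zero_of_re_radial {ι : Type*} [Fintype ι] (hι : 1 < Fintype.card ι)
    {g : ℝ → ℝ} {Φ : (ι → ℂ) → ℂ} {U : Set (ι → ℂ)} (hU : IsOpen U)
    (hΦ : DifferentiableOn ℂ Φ U) (hg : ∀ z ∈ U, (Φ z).re = g (∑ j, ‖z j‖ ^ 2))
    {z : ι → ℂ} (hz : z ∈ U) : fderiv ℂ Φ z = 0 := by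
  have houtward : ∀ v : ι → ℂ, 0 ≤ (star z ⬝ᵥ v).re → (fderiv ℂ Φ z v).re = 0 := fun v hv ↦ by
    have hline : HasDerivAt (fun t : ℝ ↦ z + (t : ℂ) • v) v 0 := by
      simpa using ((Complex.ofRealCLM.hasDerivAt (x := 0)).smul_const v).const_add z
    have hderiv : HasDerivAt (fun t : ℝ ↦ (Φ (z + (t : ℂ) • v)).re) (fderiv ℂ Φ z v).re 0 := by
      have hΦz : HasFDerivAt Φ (fderiv ℂ Φ z) (z + ((0 : ℝ) : ℂ) • v) := by
        simpa using (hΦ.differentiableAt (hU.mem_nhds hz)).hasFDerivAt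
      have hcomp : HasDerivAt (fun t : ℝ ↦ Φ (z + (t : ℂ) • v)) (fderiv ℂ Φ z v) 0 :=
        HasFDerivAt.comp_hasDerivAt (l := Φ) (l' := (fderiv ℂ Φ z).restrictScalars ℝ) 0
          (hΦz.restrictScalars ℝ) hline
      exact Complex.reCLM.hasFDerivAt.comp_hasDerivAt 0 hcomp
    have hmem : ∀ᶠ t : ℝ in 𝓝[>] 0, z + (t : ℂ) • v ∈ U :=
      nhdsWithin_le_nhds (hline.continuousAt (hU.mem_nhds (by simpa using hz)))
    have hsphere : Tendsto (fun t : ℝ ↦ ∑ j, ‖(z + (t : ℂ) • v) j‖ ^ 2) (𝓝[>] 0)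
        (𝓝[≥] (∑ j, ‖z j‖ ^ 2)) := by
      refine tendsto_nhdsWithin_iff.2 ⟨?_, ?_⟩
      · have hcont : Continuous fun t : ℝ ↦ ∑ j, ‖(z + (t : ℂ) • v) j‖ ^ 2 := by
          simp only [Pi.add_apply, Pi.smul_apply]
          fun_prop
        simpa using (hcont.tendsto 0).mono_left nhdsWithin_le_nhds
      · filter_upwards [self_mem_nhdsWithin] with t ht
        rw [Set.mem_Ici, sum_norm_sq_add, dotProduct_smul, smul_eq_mul, Complex.re_ofReal_mul,
          add_assoc, le_add_iff_nonneg_right]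
        have := mul_nonneg (le_of_lt ht) hv
        positivity
    have hconst : (fun t : ℝ ↦ (Φ (z + (t : ℂ) • v)).re) =ᶠ[𝓝[>] 0] fun _ ↦ (Φ z).re := by
      filter_upwards [hmem, hsphere.eventually (eventually_radial_profile_eq hι hU hΦ hg hz)]
        with t ht htg
      rw [hg _ ht, htg, hg z hz]
    exact (uniqueDiffWithinAt_Ioi 0).eq_deriv _ hderiv.hasDerivWithinAt
      ((hasDerivWithinAt_const _ _ _).congr_of_eventuallyEq hconst (by simp))
  have hre : ∀ v, (fderiv ℂ Φ z v).re = 0 := fun v ↦ by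
    rcases le_total 0 (star z ⬝ᵥ v).re with hv | hv
    · exact houtward v hv
    · simpa using houtward (-v) (by simpa using hv)
  ext1 v
  refine Complex.ext (hre v) ?_
  simpa using hre (Complex.I • v)

/-- if the real part of a holomorphic function `Φ` on an open connected
set `U ⊆ ℂⁿ`, `n ≥ 2`, is a radial function `G(|z₁|² + ⋯ + |zₙ|²)` with `G` smooth on
`(0,∞)`, then `G` is constant (on the relevant set). -/
theorem radial_real_part_of_holomorphic_is_constant
    (n : ℕ) (hn : 2 ≤ n) (G : ℝ → ℝ) (Φ : (Fin n → ℂ) → ℂ) (U : Set (Fin n → ℂ))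
    (hUopen : IsOpen U) (hUconn : IsPreconnected U) (hUne : U.Nonempty)
    (hG : ContDiffOn ℝ (⊤ : ℕ∞) G (Set.Ioi 0))
    (hΦ : DifferentiableOn ℂ Φ U)
    (heq : ∀ z ∈ U, (G (∑ j, ‖z j‖ ^ 2) : ℂ) = Φ z + starRingEnd ℂ (Φ z)) :
    ∃ d : ℝ, ∀ z ∈ U, G (∑ j, ‖z j‖ ^ 2) = d := by
  have hre : ∀ z ∈ U, (Φ z).re = G (∑ j, ‖z j‖ ^ 2) / 2 := fun z hz ↦ by
    have h := heq z hz
    rw [Complex.add_conj, Complex.ofReal_inj] at h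
    rw [h]
    ring
  obtain ⟨a, ha⟩ := hUopen.exists_is_const_of_fderiv_eq_zero hUconn hΦ fun z hz ↦
    fderiv_eq_zero_of_re_radial (g := fun r ↦ G r / 2) (by rwa [Fintype.card_fin]) hUopen hΦ hre hz
  refine ⟨2 * a.re, fun z hz ↦ ?_⟩
  have h := heq z hz
  rwa [ha z hz, Complex.add_conj, Complex.ofReal_inj] at h
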